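/- arXiv:1012.5117 — 2 statements merged into one kernel-verified Lean document; each statement's English description precedes it below -/
import Mathlib

section
/- Let G be a finite d-regular graph on n vertices such that every ball of radius R contains at most one cycle. Then for any r = R - Δ with Δ ≥ 1, the number of vertices x with tx(B(x,r)) = 0 (i.e., whose r-ball is a tree) is at least (1 - (d-1)^{-Δ})·n. -/
open SimpleGraph

/-- The ball of radius `r` around `x` in the graph distance of `G`. -/
def gBall {V : Type} (G : SimpleGraph V) (x : V) (r : ℕ) : Set V :=
  {y | G.dist x y ≤ r}

/-- A set of vertices `C` is a cycle (as a subgraph) if it is finite, nonempty,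
induces a connected subgraph, and every vertex of `C` has exactly two
neighbours inside `C`. -/
def IsCycleSet {V : Type} (G : SimpleGraph V) (C : Set V) : Prop :=
  C.Finite ∧ C.Nonempty ∧ (G.induce C).Connected ∧
    ∀ v ∈ C, Nat.card {w : V // w ∈ C ∧ G.Adj v w} = 2

open Classical in
/-- number of ordered adjacent pairs inside `S` -/
noncomputable def mm {V : Type} (G : SimpleGraph V) (S : Finset V) : ℕ :=
  ∑ v ∈ S, ∑ w ∈ S, if G.Adj v w then 1 else 0

open Classical in
/-- degree inside `S` -/
noncomputable def dg {V : Type} (G : SimpleGraph V) (S : Finset V) (v : V) : ℕ :=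
  ∑ w ∈ S, if G.Adj v w then 1 else 0

open Classical in
lemma mm_erase {V : Type} (G : SimpleGraph V) (S : Finset V) (a : V) (ha : a ∈ S) :
    mm G S = mm G (S.erase a) + 2 * dg G S a := by
  obtain ⟨T, haT, rfl⟩ : ∃ T, a ∉ T ∧ S = insert a T :=
    ⟨S.erase a, by simp, by simp [Finset.insert_erase ha]⟩
  rw [Finset.erase_insert haT]
  unfold mm dg
  simp only [Finset.sum_insert haT, Finset.sum_add_distrib, G.irrefl, if_false]
  have : ∑ x ∈ T, (if G.Adj x a then 1 else 0) = ∑ x ∈ T, (if G.Adj a x then 1 else 0) := by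
    simp only [G.adj_comm]
  rw [this]; ring

open Classical in
lemma mm_edge {V : Type} (G G' : SimpleGraph V) (S : Finset V) (u v : V) (hu : u ∈ S) (hv : v ∈ S)
    (huv : u ≠ v) (hn : ¬ G'.Adj u v)
    (h : ∀ x y, G.Adj x y ↔ G'.Adj x y ∨ (x = u ∧ y = v) ∨ (x = v ∧ y = u)) :
    mm G S = mm G' S + 2 := by
  have hn' : ¬ G'.Adj v u := fun h => hn h.symm
  have key : ∀ x y, (if G.Adj x y then 1 else 0) = (if G'.Adj x y then 1 else 0)
      + (if x = u then (if y = v then 1 else 0) else 0)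
      + (if x = v then (if y = u then 1 else 0) else 0) := by
    intro x y
    have := h x y
    by_cases h1 : x = u <;> by_cases h2 : y = v <;> by_cases h3 : x = v <;> by_cases h4 : y = u <;>
      simp_all
  unfold mm
  simp only [key, Finset.sum_add_distrib]
  simp [hu, hv, Finset.sum_ite_irrel]

open Classical in
lemma acyclic_mm {V : Type} (G : SimpleGraph V) (S : Finset V) (hS : S.Nonempty)
    (h : (G.induce (S : Set V)).IsAcyclic) : mm G S + 2 ≤ 2 * S.card := by
  have : Nonempty (S : Set V) := by
    obtain ⟨x, hx⟩ := hS; exact ⟨⟨x, hx⟩⟩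
  obtain ⟨T, hT, hle, hTt⟩ : ∃ T, G.induce (S : Set V) ≤ T ∧ T ≤ ⊤ ∧ T.IsTree := by
    obtain ⟨T, h1, h2, h3⟩ :=
      (connected_top (V := (S : Set V))).exists_isTree_le_of_le_of_isAcyclic le_top h
    exact ⟨T, by assumption, by assumption, by assumption⟩
  have h1 := hTt.card_edgeFinset
  have h2 : (G.induce (S : Set V)).edgeFinset.card ≤ T.edgeFinset.card :=
    Finset.card_le_card (by simpa using hT)
  have h3 := (G.induce (S : Set V)).two_mul_card_edgeFinset
  have h4 : Fintype.card (S : Set V) = S.card := by simp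
  have h5 : mm G S =
      (Finset.univ.filter fun (x, y) ↦ (G.induce (S : Set V)).Adj x y).card := by
    rw [Finset.card_filter]
    rw [← Finset.univ_product_univ, Finset.sum_product]
    unfold mm
    rw [← Finset.sum_coe_sort]
    refine Fintype.sum_congr _ _ fun x => ?_
    rw [← Finset.sum_coe_sort]
    refine Fintype.sum_congr _ _ fun y => ?_
    exact if_congr Iff.rfl rfl rfl
  have h6 : mm G S = 2 * (G.induce (S : Set V)).edgeFinset.card := by
    rw [h5, h3]
  omega

open Classical in
lemma theta {V : Type} (G K : SimpleGraph V) (hK : K ≤ G) (D : Finset V)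
    (hdeg : ∀ x ∈ D, dg K D x = 2) (u v a : V) (hu : u ∈ D) (hv : v ∈ D) (huv : G.Adj u v)
    (hn : ¬ K.Adj u v) (ha : a ∈ D) (hau : a ≠ u) (hav : a ≠ v) :
    ¬ (G.induce ((D.erase a : Finset V) : Set V)).IsAcyclic := by
  intro hac
  obtain ⟨K', hKa⟩ : ∃ K' : SimpleGraph V, ∀ x y, K'.Adj x y ↔
      (K.Adj x y ∨ (x = u ∧ y = v) ∨ (x = v ∧ y = u)) := ⟨
    { Adj := fun x y => K.Adj x y ∨ (x = u ∧ y = v) ∨ (x = v ∧ y = u)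
      symm := ⟨fun x y h => by rcases h with h | h | h <;> [left; right; right] <;> [exact h.symm; tauto; tauto]⟩
      loopless := ⟨fun x h => by
        rcases h with h | h | h
        · exact K.irrefl h
        · exact huv.ne (h.1.symm.trans h.2)
        · exact huv.ne (h.2.symm.trans h.1)⟩ }, fun _ _ => Iff.rfl⟩
  have hK' : K' ≤ G := by
    intro x y h
    rw [hKa] at h
    rcases h with h | ⟨rfl, rfl⟩ | ⟨rfl, rfl⟩
    · exact hK h
    · exact huv
    · exact huv.symm
  have hac' : (K'.induce ((D.erase a : Finset V) : Set V)).IsAcyclic :=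
    hac.anti (fun x y h => hK' h)
  have h1 := acyclic_mm K' (D.erase a) ⟨u, by simp [hu, hau.symm]⟩ hac'
  have h2 := mm_edge K' K D u v hu hv huv.ne hn hKa
  have h3 := mm_erase K' D a ha
  have h4 : dg K' D a = 2 := by
    rw [← hdeg a ha]
    unfold dg
    refine Finset.sum_congr rfl fun w _ => ?_
    have : K'.Adj a w ↔ K.Adj a w := by
      rw [hKa]
      constructor
      · rintro (h | h | h)
        · exact h
        · exact absurd h.1 hau
        · exact absurd h.1 hav
      · exact Or.inl
    exact if_congr this rfl rfl
  have h5 : mm K D = D.card * 2 := Finset.sum_const_nat hdeg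
  have h6 := Finset.card_erase_of_mem ha
  have h7 : 0 < D.card := Finset.card_pos.2 ⟨a, ha⟩
  omega

open Classical in
lemma dg_eq {V : Type} (G : SimpleGraph V) (S : Finset V) (v : V) :
    dg G S v = Nat.card {w : V // w ∈ (S : Set V) ∧ G.Adj v w} := by
  have : dg G S v = (S.filter (G.Adj v)).card := by
    unfold dg; rw [Finset.card_filter]
  rw [this]
  symm
  apply Nat.subtype_card
  intro x
  simp

lemma exists_cycleSet {V : Type} (G : SimpleGraph V) (S : Finset V)
    (h : ¬ (G.induce (S : Set V)).IsAcyclic) :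
    ∃ C : Finset V, C ⊆ S ∧ IsCycleSet G (C : Set V) := by
  classical
  induction S using Finset.strongInduction with
  | H S ih =>
  by_cases hsub : ∃ T, T ⊂ S ∧ ¬ (G.induce (T : Set V)).IsAcyclic
  · obtain ⟨T, hT, hT'⟩ := hsub
    obtain ⟨C, hC, hC'⟩ := ih T hT hT'
    exact ⟨C, hC.trans hT.1, hC'⟩
  push Not at hsub
  refine ⟨S, le_rfl, ?_⟩
  unfold IsAcyclic at h
  push Not at h
  obtain ⟨x, q, hq, hqS⟩ : ∃ x, ∃ q : G.Walk x x, q.IsCycle ∧ ∀ z ∈ q.support, z ∈ S := by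
    obtain ⟨x, p, hp⟩ := h
    refine ⟨_, p.map (Embedding.induce (G := G) (S : Set V)).toHom,
      hp.map (f := (Embedding.induce (G := G) (S : Set V)).toHom)
        (Embedding.induce (G := G) (S : Set V)).injective, ?_⟩
    intro y hy
    rw [Walk.support_map, List.mem_map] at hy
    obtain ⟨z, _, rfl⟩ := hy
    exact z.2
  have hsup : q.support.toFinset = S := by
    by_contra hne
    have := hsub _ (Finset.ssubset_iff_subset_ne.2 ⟨fun z hz => hqS z (by simpa using hz), hne⟩)
    have hw : ∀ z ∈ q.support, z ∈ (q.support.toFinset : Set V) := by simp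
    refine this (q.induce _ hw) ?_
    rw [← Walk.isCycle_map_iff_of_injective (f := (Embedding.induce (G := G) _).toHom)
      (Embedding.induce (G := G) _).injective, Walk.map_induce]
    exact hq
  have hmem : ∀ y, y ∈ q.support ↔ y ∈ S := fun y => by rw [← hsup]; simp
  have hconn : (G.induce (S : Set V)).Connected := by
    have := q.connected_induce_support
    convert this using 2 <;> (try ext y) <;> simp [hmem]
  let K := q.toSubgraph.spanningCoe
  have hKG : K ≤ G := q.toSubgraph.spanningCoe_le
  have hKdeg : ∀ x ∈ S, dg K S x = 2 := by
    intro y hy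
    rw [dg_eq, ← hq.ncard_neighborSet_toSubgraph_eq_two ((hmem y).2 hy), ← Nat.card_coe_set_eq]
    refine Nat.card_congr (Equiv.subtypeEquivRight fun w => ?_)
    refine ⟨fun h => h.2, fun h => ⟨?_, h⟩⟩
    have hw : w ∈ q.toSubgraph.verts := q.toSubgraph.edge_vert (Subgraph.Adj.symm h)
    rw [Walk.mem_verts_toSubgraph] at hw
    exact (hmem w).1 hw
  have h3 : 3 ≤ S.card := by
    have hxS := (hmem x).1 q.start_mem_support
    have h2 := hKdeg x hxS
    have h2' : (S.filter (K.Adj x)).card = 2 := by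
      rw [← h2]; unfold dg; rw [Finset.card_filter]
    have : S.filter (K.Adj x) ⊂ S := by
      refine Finset.ssubset_iff_subset_ne.2 ⟨Finset.filter_subset _ _, fun he => ?_⟩
      rw [← he] at hxS
      simp at hxS
    have := Finset.card_lt_card this
    omega
  have hKadj : ∀ u ∈ S, ∀ v ∈ S, G.Adj u v → K.Adj u v := by
    intro u hu v hv huv
    by_contra hn
    obtain ⟨a, ha, ha'⟩ : ∃ a ∈ S, a ∉ ({u, v} : Finset V) := by
      apply Finset.exists_mem_notMem_of_card_lt_card
      have := Finset.card_le_two (a := u) (b := v)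
      omega
    simp at ha'
    exact theta G K hKG S hKdeg u v a hu hv huv hn ha ha'.1 ha'.2
      (hsub _ (Finset.erase_ssubset ha))
  refine ⟨S.finite_toSet, ⟨x, (hmem x).1 q.start_mem_support⟩, hconn, fun v hv => ?_⟩
  rw [← dg_eq, ← hKdeg v hv]
  unfold dg
  refine Finset.sum_congr rfl fun w hw => ?_
  have : G.Adj v w ↔ K.Adj v w := ⟨hKadj v hv w hw, fun h => hKG h⟩
  simp [this]

lemma mm_le {V : Type} (G : SimpleGraph V) (S : Finset V)
    (h : ∀ C D : Finset V, C ⊆ S → D ⊆ S → IsCycleSet G (C : Set V) → IsCycleSet G (D : Set V) →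
      C = D) : mm G S ≤ 2 * S.card := by
  classical
  rcases S.eq_empty_or_nonempty with rfl | hS
  · simp [mm]
  by_cases hac : (G.induce (S : Set V)).IsAcyclic
  · have := acyclic_mm G S hS hac; omega
  obtain ⟨C, hCS, hC⟩ := exists_cycleSet G S hac
  have hCdeg : ∀ x ∈ C, dg G C x = 2 := fun x hx => by rw [dg_eq]; exact hC.2.2.2 x hx
  obtain ⟨u, hu⟩ := hC.2.1
  have hu : u ∈ C := hu
  have huf : (C.filter (G.Adj u)).card = 2 := by
    rw [← hCdeg u hu]; unfold dg; rw [Finset.card_filter]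
  obtain ⟨v, hv⟩ : (C.filter (G.Adj u)).Nonempty := by
    rw [← Finset.card_pos]; omega
  simp only [Finset.mem_filter] at hv
  obtain ⟨hv, huv⟩ := hv
  have hC3 : 2 < C.card := by
    have : C.filter (G.Adj u) ⊂ C := by
      refine Finset.ssubset_iff_subset_ne.2 ⟨Finset.filter_subset _ _, fun he => ?_⟩
      rw [← he] at hu
      simp at hu
    have := Finset.card_lt_card this
    omega
  let G' := G.deleteEdges {s(u, v)}
  have hG' : ∀ x y, G.Adj x y ↔ G'.Adj x y ∨ (x = u ∧ y = v) ∨ (x = v ∧ y = u) := by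
    intro x y
    simp only [G', deleteEdges_adj, Set.mem_singleton_iff, Sym2.eq_iff]
    constructor
    · intro h; tauto
    · rintro (h | ⟨rfl, rfl⟩ | ⟨rfl, rfl⟩)
      · exact h.1
      · exact huv
      · exact huv.symm
  have hn : ¬ G'.Adj u v := by simp [G']
  have hm := mm_edge G G' S u v (hCS hu) (hCS hv) huv.ne hn hG'
  by_cases hac' : (G'.induce (S : Set V)).IsAcyclic
  · have := acyclic_mm G' S hS hac'; omega
  exfalso
  obtain ⟨D, hDS, hD⟩ := exists_cycleSet G' S hac'
  have hDdeg : ∀ x ∈ D, dg G' D x = 2 := fun x hx => by rw [dg_eq]; exact hD.2.2.2 x hx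
  have hle : G' ≤ G := deleteEdges_le _
  by_cases huvD : u ∈ D ∧ v ∈ D
  · have hCa : ∀ a ∈ D, a ≠ u → a ≠ v → a ∉ C := by
      intro a ha hau hav haC
      have := theta G G' hle D hDdeg u v a huvD.1 huvD.2 huv hn ha hau hav
      obtain ⟨C', hC'D, hC'⟩ := exists_cycleSet G _ this
      have := h C C' hCS (hC'D.trans ((Finset.erase_subset _ _).trans hDS)) hC hC'
      subst this
      simpa using hC'D haC
    by_cases hex : ∃ a ∈ D, a ≠ u ∧ a ≠ v
    · obtain ⟨a, ha, hau, hav⟩ := hex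
      have := theta G G' hle D hDdeg u v a huvD.1 huvD.2 huv hn ha hau hav
      obtain ⟨C', hC'D, hC'⟩ := exists_cycleSet G _ this
      have := h C C' hCS (hC'D.trans ((Finset.erase_subset _ _).trans hDS)) hC hC'
      subst this
      have : C ⊆ {u, v} := by
        intro b hb
        by_contra hb'
        simp at hb'
        exact hCa b (Finset.mem_of_mem_erase (hC'D hb)) hb'.1 hb'.2 hb
      have := Finset.card_le_card this
      have := Finset.card_le_two (a := u) (b := v)
      omega
    · push Not at hex
      have h0 : dg G' D u = 0 := by
        unfold dg
        refine Finset.sum_eq_zero fun w hw => ?_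
        rw [if_neg]
        intro hadj
        by_cases hwu : w = u
        · subst hwu; exact G'.irrefl hadj
        · have := hex w hw hwu
          subst this; exact hn hadj
      have := hDdeg u huvD.1
      omega
  · have hadj : ∀ x ∈ D, ∀ y ∈ D, (G.Adj x y ↔ G'.Adj x y) := by
      intro x hx y hy
      rw [hG']
      constructor
      · rintro (h | ⟨rfl, rfl⟩ | ⟨rfl, rfl⟩)
        · exact h
        · exact absurd ⟨hx, hy⟩ huvD
        · exact absurd ⟨hy, hx⟩ huvD
      · exact Or.inl
    have hDG : IsCycleSet G (D : Set V) := by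
      refine ⟨hD.1, hD.2.1, hD.2.2.1.mono fun x y h => hle h, fun x hx => ?_⟩
      rw [← dg_eq, ← hDdeg x hx]
      unfold dg
      exact Finset.sum_congr rfl fun w hw => by simp [hadj x hx w hw]
    have := h C D hCS hDS hC hDG
    subst this
    exact huvD ⟨hu, hv⟩

lemma expand {V : Type} [Fintype V] (G : SimpleGraph V) (d : ℕ)
    (hreg : ∀ v : V, Nat.card (G.neighborSet v) = d) (A B : Finset V)
    (hAB : ∀ x ∈ A, ∀ y, G.Adj x y → y ∈ B) (hAB' : A ⊆ B)
    (hA : mm G A ≤ 2 * A.card) (hB : mm G B ≤ 2 * B.card) : (d - 1) * A.card ≤ B.card := by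
  classical
  obtain ⟨E, hE, rfl⟩ : ∃ E, Disjoint A E ∧ B = A ∪ E :=
    ⟨B \ A, Finset.disjoint_sdiff, by simp [hAB']⟩
  have h1 : ∑ v ∈ A, dg G (A ∪ E) v = A.card * d := by
    refine Finset.sum_const_nat fun x hx => ?_
    rw [dg_eq, ← hreg x]
    refine Nat.card_congr (Equiv.subtypeEquivRight fun w => ?_)
    exact ⟨fun h => h.2, fun h => ⟨hAB x hx w h, h⟩⟩
  unfold mm at hA hB
  unfold dg at h1
  simp only [Finset.sum_union hE, Finset.sum_add_distrib] at h1 hB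
  have h2 : ∑ x ∈ A, ∑ y ∈ E, (if G.Adj x y then 1 else 0)
      = ∑ x ∈ E, ∑ y ∈ A, (if G.Adj x y then 1 else 0) := by
    rw [Finset.sum_comm]; simp only [G.adj_comm]
  rcases d with _ | d
  · simp
  simp only [Nat.add_sub_cancel]
  rw [← h2] at hB
  generalize (∑ x ∈ E, ∑ w ∈ E, if G.Adj x w then 1 else 0) = s1 at *
  generalize (∑ x ∈ A, ∑ w ∈ E, if G.Adj x w then 1 else 0) = s2 at *
  generalize (∑ x ∈ A, ∑ w ∈ A, if G.Adj x w then 1 else 0) = s3 at *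
  have : A.card * (d + 1) = d * A.card + A.card := by ring
  omega

/-- In a finite `d`-regular graph on `n` vertices in which every ball of
radius `R` contains at most one cycle, for `r = R - Δ` with `Δ ≥ 1` the number
of vertices `x` whose ball `B(x,r)` induces a tree (tree excess `0`, i.e. the
induced subgraph is acyclic) is at least `(1 - (d-1)^{-Δ})·n`. -/
theorem stmt_11 {V : Type} [Fintype V] (G : SimpleGraph V) (d R Δ : ℕ)
    (hd : 3 ≤ d) (hΔ : 1 ≤ Δ) (hΔR : Δ ≤ R)
    (hreg : ∀ v : V, Nat.card (G.neighborSet v) = d)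
    (hball : ∀ x : V, {C : Set V | C ⊆ gBall G x R ∧ IsCycleSet G C}.Subsingleton) :
    (1 - (((d : ℝ) - 1)⁻¹) ^ Δ) * (Fintype.card V : ℝ)
      ≤ (Nat.card {x : V // (G.induce (gBall G x (R - Δ))).IsAcyclic} : ℝ) := by
  classical
  let X : Finset V → ℕ → Finset V := fun C k => Finset.univ.filter fun y => ∀ c ∈ C, G.dist y c ≤ k
  have hXmm : ∀ C : Finset V, IsCycleSet G (C : Set V) → ∀ k ≤ R, mm G (X C k) ≤ 2 * (X C k).card := by
    intro C hC k hk
    obtain ⟨c, hc⟩ := hC.2.1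
    have hsub : ∀ D : Finset V, D ⊆ X C k → (D : Set V) ⊆ gBall G c R := by
      intro D hD y hy
      have := hD hy
      simp only [X, Finset.mem_filter] at this
      have := this.2 c hc
      show G.dist c y ≤ R
      rw [dist_comm]; omega
    refine mm_le G _ fun D D' hD hD' hDc hDc' => ?_
    exact_mod_cast hball c ⟨hsub D hD, hDc⟩ ⟨hsub D' hD', hDc'⟩
  have hstep : ∀ C : Finset V, IsCycleSet G (C : Set V) → ∀ k, k + 1 ≤ R →
      (d - 1) * (X C k).card ≤ (X C (k + 1)).card := by
    intro C hC k hk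
    refine expand G d hreg _ _ ?_ ?_ (hXmm C hC k (by omega)) (hXmm C hC _ hk)
    · intro x hx y hxy
      simp only [X, Finset.mem_filter, Finset.mem_univ, true_and] at hx ⊢
      intro c hc
      have h1 := hx c hc
      have h2 := hxy.symm.reachable.dist_triangle_left c
      have h3 : G.dist y x = 1 := dist_eq_one_iff_adj.2 hxy.symm
      omega
    · intro x hx
      simp only [X, Finset.mem_filter, Finset.mem_univ, true_and] at hx ⊢
      intro c hc
      have := hx c hc
      omega
  have hpow : ∀ C : Finset V, IsCycleSet G (C : Set V) → ∀ j, j ≤ Δ →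
      (d - 1) ^ j * (X C (R - Δ)).card ≤ (X C (R - Δ + j)).card := by
    intro C hC j
    induction j with
    | zero => simp
    | succ j ih =>
      intro hj
      have h1 := ih (by omega)
      have h2 := hstep C hC (R - Δ + j) (by omega)
      calc (d - 1) ^ (j + 1) * (X C (R - Δ)).card
          = (d - 1) * ((d - 1) ^ j * (X C (R - Δ)).card) := by ring
        _ ≤ (d - 1) * (X C (R - Δ + j)).card := Nat.mul_le_mul_left _ h1
        _ ≤ _ := h2
  let CC : Finset (Finset V) := Finset.univ.filter fun C => IsCycleSet G (C : Set V)
  have hdisj : ∑ C ∈ CC, (X C R).card ≤ Fintype.card V := by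
    rw [← Finset.card_biUnion]
    · exact Finset.card_le_univ _
    · intro C hC D hD hne
      show Disjoint (X C R) (X D R)
      rw [Finset.disjoint_left]
      intro y hy hy'
      simp only [X, CC, Finset.mem_filter, Finset.mem_univ, true_and, Finset.coe_filter, Set.mem_ofPred_eq] at hy hy' hC hD
      apply hne
      exact_mod_cast hball y ⟨fun c hc => hy c hc, hC⟩ ⟨fun c hc => hy' c hc, hD⟩
  let bad : Finset V := Finset.univ.filter fun x => ¬ (G.induce (gBall G x (R - Δ))).IsAcyclic
  have hbad : bad.card ≤ ∑ C ∈ CC, (X C (R - Δ)).card := by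
    refine le_trans (Finset.card_le_card ?_) Finset.card_biUnion_le
    intro x hx
    simp only [bad, Finset.mem_filter, Finset.mem_univ, true_and] at hx
    obtain ⟨C, hC, hC'⟩ := exists_cycleSet G (gBall G x (R - Δ)).toFinset (by rwa [Set.coe_toFinset])
    simp only [Finset.mem_biUnion]
    refine ⟨C, by simpa [CC] using hC', ?_⟩
    simp only [X, Finset.mem_filter, Finset.mem_univ, true_and]
    intro c hc
    have := hC hc
    rw [Set.mem_toFinset] at this
    exact this
  have hmain : (d - 1) ^ Δ * bad.card ≤ Fintype.card V := by
    calc _ ≤ (d - 1) ^ Δ * ∑ C ∈ CC, (X C (R - Δ)).card := Nat.mul_le_mul_left _ hbad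
      _ = ∑ C ∈ CC, (d - 1) ^ Δ * (X C (R - Δ)).card := Finset.mul_sum _ _ _
      _ ≤ ∑ C ∈ CC, (X C R).card := by
        refine Finset.sum_le_sum fun C hC => ?_
        have := hpow C (by simpa [CC] using hC) Δ le_rfl
        rwa [Nat.sub_add_cancel hΔR] at this
      _ ≤ _ := hdisj
  have hsum : Nat.card {x : V // (G.induce (gBall G x (R - Δ))).IsAcyclic} + bad.card
      = Fintype.card V := by
    rw [Nat.card_eq_fintype_card, Fintype.card_subtype]
    exact Finset.card_filter_add_card_filter_not _
  have hsumR : (Nat.card {x : V // (G.induce (gBall G x (R - Δ))).IsAcyclic} : ℝ) + bad.card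
      = Fintype.card V := by exact_mod_cast hsum
  have hmainR : ((d : ℝ) - 1) ^ Δ * bad.card ≤ Fintype.card V := by
    have : (((d - 1) ^ Δ * bad.card : ℕ) : ℝ) ≤ (Fintype.card V : ℕ) := by exact_mod_cast hmain
    push_cast [Nat.cast_sub (show 1 ≤ d by omega)] at this
    exact this
  have hpos : (0 : ℝ) < ((d : ℝ) - 1) ^ Δ := by
    apply pow_pos
    have : (3 : ℝ) ≤ d := by exact_mod_cast hd
    linarith
  have : (bad.card : ℝ) ≤ (((d : ℝ) - 1)⁻¹) ^ Δ * Fintype.card V := by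
    rw [inv_pow, ← div_eq_inv_mul, le_div_iff₀ hpos]
    linarith
  linarith
end

section
/- Let G be a d-regular graph in which the ball B(x, R) contains exactly one cycle C of length |C| with diameter ℓ_C = ⌊|C|/2⌋. Then the set N_C(R) = {y : C ⊆ B(y, R)} induces a subgraph consisting of the cycle C together with disjoint trees of depth R - ℓ_C rooted at the vertices of C, and |N_C(R)| = |C|·(d-1)^{R-ℓ_C}. -/
open SimpleGraph

/-- The graph `G[S]` with the edge `ab` removed (on all of `V`). -/
def cutGraph {V : Type} (G : SimpleGraph V) (S : Set V) (a b : V) : SimpleGraph V where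
  Adj u v := G.Adj u v ∧ u ∈ S ∧ v ∈ S ∧ s(u, v) ≠ s(a, b)
  symm := ⟨fun u v h => ⟨h.1.symm, h.2.2.1, h.2.1, by rw [Sym2.eq_swap]; exact h.2.2.2⟩⟩
  loopless := ⟨fun u h => G.loopless.irrefl u h.1⟩

theorem isCycleSet_of_fun {V : Type} (G : SimpleGraph V) (m : ℕ) (hm : 2 ≤ m) (f : ℕ → V)
    (hinj : ∀ i ≤ m, ∀ j ≤ m, f i = f j → i = j)
    (hadj : ∀ i ≤ m, ∀ j ≤ m, G.Adj (f i) (f j) ↔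
      (j = i + 1 ∨ i = j + 1 ∨ (i = 0 ∧ j = m) ∨ (i = m ∧ j = 0))) :
    IsCycleSet G (f '' Set.Iic m) := by
  refine ⟨(Set.finite_Iic m).image f, ⟨f 0, 0, by simp, rfl⟩, ?_, ?_⟩
  · rw [connected_iff_exists_forall_reachable]
    refine ⟨⟨f 0, 0, by simp, rfl⟩, ?_⟩
    rintro ⟨v, i, hi, rfl⟩
    induction i with
    | zero => exact Reachable.refl _
    | succ k ih =>
      have hk : k + 1 ≤ m := hi
      have hk' : k ∈ Set.Iic m := by simp; omega
      refine (ih hk').trans (Adj.reachable ?_)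
      simp only [comap_adj, Function.Embedding.subtype_apply]
      exact (hadj k (by omega) (k+1) hk).2 (by omega)
  · rintro v ⟨i, hi, rfl⟩
    have hi : i ≤ m := hi
    obtain ⟨j, k, hj, hk, hjk, hall⟩ : ∃ j k, j ≤ m ∧ k ≤ m ∧ j ≠ k ∧
        ∀ t ≤ m, ((t = i + 1 ∨ i = t + 1 ∨ (i = 0 ∧ t = m) ∨ (i = m ∧ t = 0)) ↔ t = j ∨ t = k) := by
      by_cases h0 : i = 0
      · exact ⟨1, m, by omega, by omega, by omega, by omega⟩
      · by_cases h1 : i = m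
        · exact ⟨0, m - 1, by omega, by omega, by omega, by omega⟩
        · exact ⟨i - 1, i + 1, by omega, by omega, by omega, by omega⟩
    have hs : {w : V | w ∈ f '' Set.Iic m ∧ G.Adj (f i) w} = {f j, f k} := by
      ext w
      constructor
      · rintro ⟨⟨t, ht, rfl⟩, hw⟩
        rcases (hall t ht).1 ((hadj i hi t ht).1 hw) with h | h <;> simp [h]
      · rintro (h | h)
        · exact ⟨⟨j, hj, h.symm⟩, by rw [h]; exact (hadj i hi j hj).2 ((hall j hj).2 (Or.inl rfl))⟩
        · have h : w = f k := h
          exact ⟨⟨k, hk, h.symm⟩, by rw [h]; exact (hadj i hi k hk).2 ((hall k hk).2 (Or.inr rfl))⟩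
    change Nat.card ({w : V | w ∈ f '' Set.Iic m ∧ G.Adj (f i) w} : Set V) = 2
    rw [hs, Nat.card_coe_set_eq, Set.ncard_pair]
    intro h
    exact hjk (hinj j hj k hk h)

theorem exists_cycleSet_of_reachable {V : Type} (G : SimpleGraph V) (S : Set V) (a b : V)
    (hab : G.Adj a b) (ha : a ∈ S) (hb : b ∈ S) (hr : (cutGraph G S a b).Reachable a b) :
    ∃ D ⊆ S, IsCycleSet G D ∧ a ∈ D ∧ b ∈ D := by
  classical
  set H := cutGraph G S a b with hH
  obtain ⟨p, hp⟩ := hr.exists_walk_length_eq_dist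
  set m := p.length with hm
  have hreach : ∀ i, H.Reachable a (p.getVert i) := fun i =>
    ⟨p.takeUntil _ (p.getVert_mem_support i)⟩
  have hd : ∀ i ≤ m, H.dist a (p.getVert i) = i := by
    intro i hi
    have h1 : H.dist a (p.getVert i) ≤ i := by
      have := dist_le (p.take i)
      rw [Walk.take_length] at this
      omega
    have h2 : H.dist (p.getVert i) b ≤ m - i := by
      have := dist_le (p.drop i)
      simpa using this
    have := (hreach i).dist_triangle_left b
    omega
  have hinj : ∀ i ≤ m, ∀ j ≤ m, p.getVert i = p.getVert j → i = j := by
    intro i hi j hj h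
    rw [← hd i hi, ← hd j hj, h]
  have h0 : p.getVert 0 = a := p.getVert_zero
  have hl : p.getVert m = b := p.getVert_length
  have hm2 : 2 ≤ m := by
    by_contra hlt
    have hm0 : m ≠ 0 := by
      intro h
      rw [h, h0] at hl
      exact hab.ne hl
    have hm1 : m = 1 := by omega
    have := p.adj_getVert_succ (i := 0) (by omega)
    rw [h0, zero_add, ← hm1, hl] at this
    exact this.2.2.2 rfl
  have hstep : ∀ i < m, H.Adj (p.getVert i) (p.getVert (i+1)) := fun i hi => p.adj_getVert_succ hi
  have hmem : ∀ i ≤ m, p.getVert i ∈ S := by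
    intro i hi
    rcases Nat.lt_or_ge i m with h | h
    · exact (hstep i h).2.1
    · have : i = m := by omega
      rw [this, hl]; exact hb
  refine ⟨p.getVert '' Set.Iic m, ?_, isCycleSet_of_fun G m hm2 _ hinj ?_, ⟨0, by simp, h0⟩,
    ⟨m, by simp, hl⟩⟩
  · rintro _ ⟨i, hi, rfl⟩
    exact hmem i hi
  · intro i hi j hj
    constructor
    · intro h
      by_cases he : s(p.getVert i, p.getVert j) = s(a, b)
      · rw [Sym2.eq_iff] at he
        rcases he with ⟨h1, h2⟩ | ⟨h1, h2⟩
        · have := hinj i hi 0 (by omega) (h1.trans h0.symm)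
          have := hinj j hj m (by omega) (h2.trans hl.symm)
          omega
        · have := hinj i hi m (by omega) (h1.trans hl.symm)
          have := hinj j hj 0 (by omega) (h2.trans h0.symm)
          omega
      · have hA : H.Adj (p.getVert i) (p.getVert j) := ⟨h, hmem i hi, hmem j hj, he⟩
        have h1 := hA.reachable.dist_triangle_right a
        have h2 := hA.symm.reachable.dist_triangle_right a
        rw [dist_eq_one_iff_adj.2 hA, hd i hi, hd j hj] at h1
        rw [dist_eq_one_iff_adj.2 hA.symm, hd i hi, hd j hj] at h2
        have : i ≠ j := by rintro rfl; exact h.ne rfl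
        omega
    · rintro (h | h | h | h)
      · subst h; exact (hstep i (by omega)).1
      · subst h; exact (hstep j (by omega)).1.symm
      · rw [h.1, h.2, h0, hl]; exact hab
      · rw [h.1, h.2, h0, hl]; exact hab.symm

theorem exists_cycleSet_of_not_acyclic {V : Type} (G : SimpleGraph V) (S : Set V)
    (h : ¬ (G.induce S).IsAcyclic) : ∃ D ⊆ S, IsCycleSet G D := by
  rw [isAcyclic_iff_forall_adj_isBridge] at h
  push Not at h
  obtain ⟨a, b, hab, hbr⟩ := h
  rw [isBridge_iff, not_not] at hbr
  let φ : ((G.induce S).deleteEdges {s(a, b)}) →g cutGraph G S a b :=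
    { toFun := Subtype.val
      map_rel' := by
        intro u v huv
        rw [deleteEdges_adj] at huv
        refine ⟨huv.1, u.2, v.2, ?_⟩
        intro he
        apply huv.2
        rw [Set.mem_singleton_iff]
        rw [Sym2.eq_iff] at he ⊢
        rcases he with ⟨h1, h2⟩ | ⟨h1, h2⟩
        · exact Or.inl ⟨Subtype.ext h1, Subtype.ext h2⟩
        · exact Or.inr ⟨Subtype.ext h1, Subtype.ext h2⟩ }
  obtain ⟨D, hD, hD', -⟩ := exists_cycleSet_of_reachable G S a b hab a.2 b.2 (hbr.map φ)
  exact ⟨D, hD, hD'⟩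

theorem not_acyclic_of_deg {W : Type} [Finite W] [Nonempty W] (H : SimpleGraph W)
    (h2 : ∀ v : W, ∃ p q, p ≠ q ∧ H.Adj v p ∧ H.Adj v q) : ¬ H.IsAcyclic := by
  intro hac
  obtain ⟨r⟩ := ‹Nonempty W›
  obtain ⟨v, hv, hmax⟩ := Set.exists_max_image {v | H.Reachable r v} (fun v => H.dist r v)
    (Set.toFinite _) ⟨r, Reachable.refl r⟩
  have key : ∀ p, H.Adj v p → ∃ w : H.Walk r v, w.IsPath ∧ w.penultimate = p := by
    intro p hp
    have hrp : H.Reachable r p := Reachable.trans hv hp.reachable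
    have h1 := hmax p hrp
    have h3 := hac.dist_eq_dist_add_one_of_adj_of_reachable (u := r) hp hv
    obtain ⟨w, hw⟩ := hrp.exists_walk_length_eq_dist
    refine ⟨w.concat hp.symm, Walk.isPath_of_length_eq_dist _ ?_, by simp⟩
    rw [Walk.length_concat, hw]
    omega
  obtain ⟨p, q, hpq, hp, hq⟩ := h2 v
  obtain ⟨w, hw, rfl⟩ := key p hp
  obtain ⟨w', hw', rfl⟩ := key q hq
  have := (hac.subsingleton_path r v).elim ⟨w, hw⟩ ⟨w', hw'⟩
  apply hpq
  rw [Subtype.mk.injEq] at this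
  rw [this]

theorem exists_cycleSet_of_deg {V : Type} [Finite V] (G : SimpleGraph V) (S : Set V)
    (hne : S.Nonempty) (h2 : ∀ v ∈ S, ∃ p ∈ S, ∃ q ∈ S, p ≠ q ∧ G.Adj v p ∧ G.Adj v q) :
    ∃ D ⊆ S, IsCycleSet G D := by
  apply exists_cycleSet_of_not_acyclic
  have : Nonempty S := hne.to_subtype
  apply not_acyclic_of_deg
  rintro ⟨v, hv⟩
  obtain ⟨p, hp, q, hq, hpq, h1, h2⟩ := h2 v hv
  exact ⟨⟨p, hp⟩, ⟨q, hq⟩, by simpa using hpq, h1, h2⟩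

theorem graph_connected {V : Type} [Fintype V] (G : SimpleGraph V) (d R : ℕ)
    (hd : 3 ≤ d)
    (hreg : ∀ v : V, Nat.card (G.neighborSet v) = d)
    (hball : ∀ x : V, {C : Set V | C ⊆ gBall G x R ∧ IsCycleSet G C}.Subsingleton)
    (hne : Nonempty V) : G.Connected := by
  refine ⟨?_⟩
  by_contra hcon
  unfold Preconnected at hcon
  push Not at hcon
  obtain ⟨x, y, hxy⟩ := hcon
  have h3 : ∀ v u : V, ∃ p q, p ≠ q ∧ p ≠ u ∧ q ≠ u ∧ G.Adj v p ∧ G.Adj v q := by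
    intro v u
    have h := hreg v
    rw [Nat.card_coe_set_eq] at h
    have h' : 1 < (G.neighborSet v \ {u}).ncard := by
      have := Set.ncard_le_ncard_sdiff_add_ncard (G.neighborSet v) {u}
      rw [Set.ncard_singleton] at this
      omega
    obtain ⟨p, q, hp, hq, hpq⟩ := (Set.one_lt_ncard_iff (Set.toFinite _)).1 h'
    exact ⟨p, q, hpq, hp.2, hq.2, hp.1, hq.1⟩
  set S : Set V := {v | G.Reachable y v} with hS
  have hSb : S ⊆ gBall G x R := by
    intro v hv
    have : ¬ G.Reachable x v := fun h => hxy (h.trans (Reachable.symm hv))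
    simp [gBall, dist_eq_zero_of_not_reachable this]
  have hclosed : ∀ v ∈ S, ∀ w, G.Adj v w → w ∈ S := fun v hv w hw => Reachable.trans hv hw.reachable
  obtain ⟨D, hD, hDc⟩ := exists_cycleSet_of_deg G S ⟨y, Reachable.refl y⟩ (by
    intro v hv
    obtain ⟨p, q, hpq, -, -, h1, h2⟩ := h3 v v
    exact ⟨p, hclosed v hv p h1, q, hclosed v hv q h2, hpq, h1, h2⟩)
  obtain ⟨u, hu⟩ := hDc.2.1
  obtain ⟨D', hD', hDc'⟩ := exists_cycleSet_of_deg G (S \ {u}) (by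
    obtain ⟨p, q, hpq, h1, h2, h3, h4⟩ := h3 u u
    exact ⟨p, hclosed u (hD hu) p h3, h1⟩) (by
    intro v hv
    obtain ⟨p, q, hpq, h1, h2, h3, h4⟩ := h3 v u
    exact ⟨p, ⟨hclosed v hv.1 p h3, h1⟩, q, ⟨hclosed v hv.1 q h4, h2⟩, hpq, h3, h4⟩)
  have : D = D' := hball x ⟨hD.trans hSb, hDc⟩ ⟨(hD'.trans Set.sdiff_subset).trans hSb, hDc'⟩
  rw [this] at hu
  exact (hD' hu).2 rfl

structure CycCtx {V : Type} (G : SimpleGraph V) (R : ℕ) (C : Set V) : Prop where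
  conn : G.Connected
  ball : ∀ x : V, {C : Set V | C ⊆ gBall G x R ∧ IsCycleSet G C}.Subsingleton
  cyc : IsCycleSet G C

theorem geo_step {V : Type} {G : SimpleGraph V} (hG : G.Connected) {u c : V} (h : u ≠ c) :
    ∃ p, G.Adj u p ∧ G.dist p c + 1 = G.dist u c := by
  obtain ⟨w, hw⟩ := hG.exists_walk_length_eq_dist u c
  cases w with
  | nil => exact absurd rfl h
  | @cons _ p _ hp w =>
    refine ⟨p, hp, ?_⟩
    have h1 := dist_le w
    have h2 := hG.dist_triangle (u := u) (v := p) (w := c)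
    rw [dist_eq_one_iff_adj.2 hp] at h2
    rw [Walk.length_cons] at hw
    omega

theorem geo_reach {V : Type} {G H : SimpleGraph V} (hG : G.Connected) (P : Set V)
    (hH : ∀ u v, G.Adj u v → u ∈ P → v ∈ P → H.Adj u v) (c : V) :
    ∀ (n : ℕ) (u : V), G.dist u c = n →
      (∀ t, G.dist u t + G.dist t c = G.dist u c → t ∈ P) → H.Reachable u c := by
  intro n
  induction n with
  | zero =>
    intro u hu _
    rw [hG.dist_eq_zero_iff] at hu
    rw [hu]
  | succ n ih =>
    intro u hu ht
    have huc : u ≠ c := by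
      rintro rfl
      simp at hu
    obtain ⟨p, hp, hpd⟩ := geo_step hG huc
    have h1 := dist_eq_one_iff_adj.2 hp
    have hpP : p ∈ P := ht p (by omega)
    have huP : u ∈ P := ht u (by simp)
    refine (hH u p hp huP hpP).reachable.trans (ih p (by omega) ?_)
    intro t htt
    apply ht
    have h2 := hG.dist_triangle (u := u) (v := p) (w := t)
    have h3 := hG.dist_triangle (u := u) (v := t) (w := c)
    omega

namespace CycCtx

variable {V : Type} {G : SimpleGraph V} {R : ℕ} {C : Set V}

theorem no_escape (h : CycCtx G R C) {x a b c₁ c₂ : V} (hx : C ⊆ gBall G x R)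
    (ha : a ∈ gBall G x R) (hb : b ∈ gBall G x R) (hab : G.Adj a b) (hC : ¬ (a ∈ C ∧ b ∈ C))
    (h1 : c₁ ∈ C) (h2 : c₂ ∈ C)
    (hr1 : (cutGraph G (gBall G x R) a b).Reachable a c₁)
    (hr2 : (cutGraph G (gBall G x R) a b).Reachable b c₂) : False := by
  let φ : G.induce C →g cutGraph G (gBall G x R) a b :=
    { toFun := Subtype.val
      map_rel' := by
        intro u v huv
        refine ⟨huv, hx u.2, hx v.2, ?_⟩
        intro he
        apply hC
        rw [Sym2.eq_iff] at he
        rcases he with ⟨h1, h2⟩ | ⟨h1, h2⟩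
        · exact ⟨h1 ▸ u.2, h2 ▸ v.2⟩
        · exact ⟨h2 ▸ v.2, h1 ▸ u.2⟩ }
  have hc : (cutGraph G (gBall G x R) a b).Reachable c₁ c₂ :=
    (h.cyc.2.2.1.preconnected ⟨c₁, h1⟩ ⟨c₂, h2⟩).map φ
  obtain ⟨D, hD, hDc, haD, hbD⟩ := exists_cycleSet_of_reachable G _ a b hab ha hb
    ((hr1.trans hc).trans hr2.symm)
  have : D = C := h.ball x ⟨hD, hDc⟩ ⟨hx, h.cyc⟩
  subst this
  exact hC ⟨haD, hbD⟩

/-- A geodesic from `u` to `c` inside the ball avoiding `a`. -/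
theorem geo_avoid (h : CycCtx G R C) {x a b u c : V}
    (ht : ∀ t, G.dist u t + G.dist t c = G.dist u c → G.dist x t ≤ R ∧ t ≠ a) :
    (cutGraph G (gBall G x R) a b).Reachable u c := by
  refine geo_reach h.conn {t | G.dist x t ≤ R ∧ t ≠ a} ?_ c _ u rfl ht
  rintro u v huv ⟨hu, hu'⟩ ⟨hv, hv'⟩
  refine ⟨huv, hu, hv, ?_⟩
  intro he
  rw [Sym2.eq_iff] at he
  tauto

theorem two_routes (h : CycCtx G R C) {z p q c₁ c₂ : V} (hz : C ⊆ gBall G z R) (hzC : z ∉ C)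
    (hR : 1 ≤ R) (hp : G.Adj z p) (hq : G.Adj z q) (h1 : c₁ ∈ C) (h2 : c₂ ∈ C)
    (ht1 : ∀ t, G.dist p t + G.dist t c₁ = G.dist p c₁ → G.dist z t ≤ R ∧ t ≠ z)
    (ht2 : ∀ t, G.dist q t + G.dist t c₂ = G.dist q c₂ → G.dist z t ≤ R ∧ t ≠ z) : p = q := by
  by_contra hpq
  have hzp := dist_eq_one_iff_adj.2 hp
  have hzq := dist_eq_one_iff_adj.2 hq
  have hzB : z ∈ gBall G z R := by simp [gBall]
  have hpB : p ∈ gBall G z R := by simp [gBall, hzp, hR]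
  have hqB : q ∈ gBall G z R := by simp [gBall, hzq, hR]
  refine h.no_escape (a := z) (b := p) hz hzB hpB hp (fun hh => hzC hh.1) h2 h1 ?_
    (h.geo_avoid ht1)
  have : (cutGraph G (gBall G z R) z p).Adj z q := by
    refine ⟨hq, hzB, hqB, ?_⟩
    intro he
    rw [Sym2.eq_iff] at he
    rcases he with ⟨_, h2⟩ | ⟨h1, h2⟩
    · exact hpq h2.symm
    · exact hp.ne h1
  exact this.reachable.trans (h.geo_avoid ht2)

theorem gate_step (h : CycCtx G R C) {z : V} (hz : C ⊆ gBall G z R) (hzC : z ∉ C) :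
    ∃ q, G.Adj z q ∧ ∀ c ∈ C, G.dist z c = G.dist q c + 1 := by
  have key : ∀ p c, G.Adj z p → c ∈ C → G.dist p c + 1 = G.dist z c →
      ∀ t, G.dist p t + G.dist t c = G.dist p c → G.dist z t ≤ R ∧ t ≠ z := by
    intro p c hp hc hd t ht
    have h1 := dist_eq_one_iff_adj.2 hp
    have h2 := h.conn.dist_triangle (u := z) (v := p) (w := t)
    have h3 : G.dist z c ≤ R := hz hc
    refine ⟨by omega, ?_⟩
    rintro rfl
    omega
  obtain ⟨c₀, hc₀⟩ := h.cyc.2.1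
  obtain ⟨q, hq, hqd⟩ := geo_step h.conn (u := z) (c := c₀) (fun hh => hzC (hh ▸ hc₀))
  have hR : 1 ≤ R := by
    have h3 : G.dist z c₀ ≤ R := hz hc₀
    omega
  refine ⟨q, hq, ?_⟩
  intro c hc
  obtain ⟨p, hp, hpd⟩ := geo_step h.conn (u := z) (c := c) (fun hh => hzC (hh ▸ hc))
  have := h.two_routes hz hzC hR hp hq hc hc₀ (key p c hp hc hpd) (key q c₀ hq hc₀ hqd)
  subst this
  exact hpd.symm

theorem gate (h : CycCtx G R C) : ∀ (n : ℕ) (z : V), (∃ c₀ ∈ C, G.dist z c₀ = n) →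
    C ⊆ gBall G z R → ∃ c ∈ C, ∃ k, ∀ c' ∈ C, G.dist z c' = k + G.dist c c' := by
  intro n
  induction n with
  | zero =>
    rintro z ⟨c₀, hc₀, hd⟩ hz
    rw [h.conn.dist_eq_zero_iff] at hd
    subst hd
    exact ⟨z, hc₀, 0, by simp⟩
  | succ n ih =>
    rintro z ⟨c₀, hc₀, hd⟩ hz
    by_cases hzC : z ∈ C
    · exact ⟨z, hzC, 0, by simp⟩
    obtain ⟨q, hq, hqd⟩ := h.gate_step hz hzC
    obtain ⟨c, hc, k, hk⟩ := ih q ⟨c₀, hc₀, by have := hqd c₀ hc₀; omega⟩ (by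
      intro c hc
      have h1 := hqd c hc
      have h2 : G.dist z c ≤ R := hz hc
      change G.dist q c ≤ R
      omega)
    refine ⟨c, hc, k + 1, ?_⟩
    intro c' hc'
    rw [hqd c' hc', hk c' hc']
    omega

theorem parent_unique (h : CycCtx G R C) {z p q c₁ c₂ : V} {j : ℕ} (hz : C ⊆ gBall G z R)
    (hj : 1 ≤ j) (hjR : j + 1 ≤ R) (hlev : ∀ c ∈ C, j ≤ G.dist z c)
    (hp : G.Adj z p) (hq : G.Adj z q) (h1 : c₁ ∈ C) (h2 : c₂ ∈ C)
    (hd1 : G.dist p c₁ ≤ j) (hd2 : G.dist q c₂ ≤ j) : p = q := by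
  have hzC : z ∉ C := by
    intro hh
    have := hlev z hh
    simp at this
    omega
  have key : ∀ p c, G.Adj z p → c ∈ C → G.dist p c ≤ j →
      ∀ t, G.dist p t + G.dist t c = G.dist p c → G.dist z t ≤ R ∧ t ≠ z := by
    intro p c hp hc hd t ht
    have h1 := dist_eq_one_iff_adj.2 hp
    have h2 := h.conn.dist_triangle (u := z) (v := p) (w := t)
    refine ⟨by omega, ?_⟩
    rintro rfl
    have := hlev c hc
    rw [dist_comm] at h1
    omega
  exact h.two_routes hz hzC (by omega) hp hq h1 h2 (key p c₁ hp h1 hd1) (key q c₂ hq h2 hd2)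

theorem step_in (h : CycCtx G R C) {c v : V} (hc : c ∈ C) (hv : v ∈ C) (hCc : C ⊆ gBall G c R)
    (hne : v ≠ c) : ∃ u ∈ C, G.Adj v u ∧ G.dist c u + 1 = G.dist c v := by
  obtain ⟨p, hp, hpd⟩ := geo_step h.conn hne
  by_cases hpC : p ∈ C
  · exact ⟨p, hpC, hp, by rw [dist_comm, hpd, dist_comm]⟩
  exfalso
  have hvR : G.dist c v ≤ R := hCc hv
  rw [dist_comm] at hvR
  have hpB : p ∈ gBall G c R := by
    change G.dist c p ≤ R
    rw [dist_comm]
    omega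
  refine h.no_escape (a := v) (b := p) hCc (hCc hv) hpB hp (fun hh => hpC hh.2) hv hc
    (Reachable.refl _) (h.geo_avoid ?_)
  intro t ht
  refine ⟨by rw [dist_comm]; omega, ?_⟩
  rintro rfl
  omega

theorem card_le (h : CycCtx G R C) {c : V} {m : ℕ} (hc : c ∈ C) (hm : m ≤ R)
    (hCc : C ⊆ gBall G c m) : Nat.card C ≤ 2 * m + 1 := by
  have hCR : C ⊆ gBall G c R := fun v hv => le_trans (hCc hv) hm
  have hfin := h.cyc.1
  have hnb : ∀ v ∈ C, {w | w ∈ C ∧ G.Adj v w}.ncard = 2 := by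
    intro v hv
    have := h.cyc.2.2.2 v hv
    rwa [← Nat.card_coe_set_eq]
  have hfinS : ∀ P : V → Prop, {v | v ∈ C ∧ P v}.Finite := fun P => hfin.subset (fun v hv => hv.1)
  have hs : ∀ i, {v | v ∈ C ∧ G.dist c v = i + 1}.ncard ≤ 2 := by
    intro i
    induction i with
    | zero =>
      rw [← hnb c hc]
      apply Set.ncard_le_ncard _ (hfinS _)
      rintro v ⟨hv, hd⟩
      exact ⟨hv, dist_eq_one_iff_adj.1 hd⟩
    | succ i ih =>
      refine le_trans ?_ ih
      have hpar : ∀ v, ∃ u, v ∈ C → v ≠ c → u ∈ C ∧ G.Adj v u ∧ G.dist c u + 1 = G.dist c v := by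
        intro v
        by_cases hv : v ∈ C ∧ v ≠ c
        · obtain ⟨u, hu, hu'⟩ := h.step_in hc hv.1 hCR hv.2
          exact ⟨u, fun _ _ => ⟨hu, hu'⟩⟩
        · exact ⟨v, fun h1 h2 => absurd ⟨h1, h2⟩ hv⟩
      choose f hf using hpar
      have hnec : ∀ v i, G.dist c v = i + 1 → v ≠ c := by
        rintro v i hd rfl
        simp at hd
      refine Set.ncard_le_ncard_of_injOn f ?_ ?_ (hfinS _)
      · rintro v ⟨hv, hd⟩
        obtain ⟨h1, h2, h3⟩ := hf v hv (hnec v _ hd)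
        exact ⟨h1, by omega⟩
      · rintro v ⟨hv, hd⟩ v' ⟨hv', hd'⟩ hvv
        by_contra hne
        obtain ⟨h1, h2, h3⟩ := hf v hv (hnec v _ hd)
        obtain ⟨h1', h2', h3'⟩ := hf v' hv' (hnec v' _ hd')
        obtain ⟨h1'', h2'', h3''⟩ := hf (f v) h1 (hnec (f v) i (by omega))
        have h4 := hnb (f v) h1
        have h5 : ({v, v', f (f v)} : Set V).ncard = 3 := by
          apply Set.ncard_eq_three.2
          refine ⟨v, v', f (f v), hne, ?_, ?_, rfl⟩
          · intro hh
            rw [← hh] at h3''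
            omega
          · intro hh
            rw [← hh] at h3''
            omega
        have h6 : ({v, v', f (f v)} : Set V) ⊆ {w | w ∈ C ∧ G.Adj (f v) w} := by
          rintro w (hw | hw | hw)
          · rw [hw]; exact ⟨hv, h2.symm⟩
          · rw [hw]; exact ⟨hv', hvv ▸ h2'.symm⟩
          · have hw : w = f (f v) := hw
            rw [hw]; exact ⟨h1'', h2''⟩
        have := Set.ncard_le_ncard h6 (hfinS _)
        omega
  have hb : ∀ i, {v | v ∈ C ∧ G.dist c v ≤ i}.ncard ≤ 2 * i + 1 := by
    intro i
    induction i with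
    | zero =>
      rw [show 2 * 0 + 1 = ({c} : Set V).ncard by simp]
      apply Set.ncard_le_ncard _ (Set.toFinite _)
      rintro v ⟨hv, hd⟩
      have : G.dist c v = 0 := by omega
      rw [h.conn.dist_eq_zero_iff] at this
      exact this.symm
    | succ i ih =>
      have : {v | v ∈ C ∧ G.dist c v ≤ i + 1} =
          {v | v ∈ C ∧ G.dist c v ≤ i} ∪ {v | v ∈ C ∧ G.dist c v = i + 1} := by
        ext v
        simp only [Set.mem_ofPred_eq, Set.mem_union]
        constructor
        · rintro ⟨h1, h2⟩
          rcases Nat.lt_or_ge i (G.dist c v) with h3 | h3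
          · exact Or.inr ⟨h1, by omega⟩
          · exact Or.inl ⟨h1, h3⟩
        · rintro (⟨h1, h2⟩ | ⟨h1, h2⟩)
          · exact ⟨h1, by omega⟩
          · exact ⟨h1, by omega⟩
      rw [this]
      have h1 := Set.ncard_union_le {v | v ∈ C ∧ G.dist c v ≤ i} {v | v ∈ C ∧ G.dist c v = i + 1}
      have h2 := hs i
      omega
  have : C = {v | v ∈ C ∧ G.dist c v ≤ m} := by
    ext v
    exact ⟨fun hv => ⟨hv, hCc hv⟩, fun hv => hv.1⟩
  rw [Nat.card_coe_set_eq, this]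
  exact hb m

end CycCtx

theorem cycle_diam {V : Type} {G : SimpleGraph V} {C : Set V} (hC : IsCycleSet G C) {c c' : V}
    (hc : c ∈ C) (hc' : c' ∈ C) : G.dist c c' ≤ Nat.card C / 2 := by
  classical
  have : Finite C := hC.1.to_subtype
  have : Fintype C := Fintype.ofFinite C
  set H := G.induce C with hH
  have hnb : ∀ v : C, (H.neighborSet v).ncard = 2 := by
    intro v
    rw [← hC.2.2.2 v v.2, ← Nat.card_coe_set_eq]
    refine Nat.card_congr
      { toFun := fun w => ⟨w.1.1, w.1.2, w.2⟩
        invFun := fun w => ⟨⟨w.1, w.2.1⟩, w.2.2⟩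
        left_inv := fun w => rfl
        right_inv := fun w => rfl }
  have hcy : H.IsCycles := fun v _ => hnb v
  obtain ⟨p, hp, hpv⟩ := hcy.exists_cycle_toSubgraph_verts_eq_connectedComponentSupp
    (v := ⟨c, hc⟩) (c := H.connectedComponentMk ⟨c, hc⟩) rfl (by
      apply Set.nonempty_of_ncard_ne_zero
      rw [hnb]; omega)
  have hmem : (⟨c', hc'⟩ : C) ∈ p.support := by
    rw [← Walk.mem_verts_toSubgraph, hpv, ConnectedComponent.mem_supp_iff,
      ConnectedComponent.eq]
    exact hC.2.2.1.preconnected _ _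
  have hlen : p.length ≤ Nat.card C := by
    have h1 := hp.support_nodup
    have h2 := h1.length_le_card
    rw [List.length_tail, Walk.length_support] at h2
    rw [Nat.card_eq_fintype_card]
    omega
  have hsplit := congrArg Walk.length (p.take_spec hmem)
  rw [Walk.length_append] at hsplit
  let φ : H →g G := (Embedding.induce C).toHom
  have h1 := dist_le ((p.takeUntil _ hmem).map φ)
  have h2 := dist_le ((p.dropUntil _ hmem).map φ)
  rw [Walk.length_map] at h1 h2
  have h1 : G.dist c c' ≤ (p.takeUntil _ hmem).length := h1
  have h2 : G.dist c' c ≤ (p.dropUntil _ hmem).length := h2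
  rw [dist_comm] at h2
  omega

/-- Distance from `v` to the set `C`. -/
noncomputable def setLev {V : Type} (G : SimpleGraph V) (C : Set V) (v : V) : ℕ :=
  sInf ((fun c => G.dist v c) '' C)

section lev

variable {V : Type} {G : SimpleGraph V} {C : Set V}

theorem setLev_le {v c : V} (hc : c ∈ C) : setLev G C v ≤ G.dist v c :=
  Nat.sInf_le ⟨c, hc, rfl⟩

theorem setLev_mem (hC : C.Nonempty) (v : V) : ∃ c ∈ C, G.dist v c = setLev G C v :=
  Nat.sInf_mem (hC.image (fun c => G.dist v c))

theorem setLev_zero (hG : G.Connected) (hC : C.Nonempty) {v : V} : setLev G C v = 0 ↔ v ∈ C := by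
  constructor
  · intro h
    obtain ⟨c, hc, hd⟩ := setLev_mem (G := G) hC v
    rw [h, hG.dist_eq_zero_iff] at hd
    rwa [hd]
  · intro h
    have := setLev_le (G := G) (v := v) h
    rw [dist_self] at this
    omega

theorem setLev_adj (hG : G.Connected) (hC : C.Nonempty) {u v : V} (h : G.Adj u v) :
    setLev G C u ≤ setLev G C v + 1 := by
  obtain ⟨c, hc, hd⟩ := setLev_mem (G := G) hC v
  have h1 := setLev_le (G := G) (v := u) hc
  have h2 := hG.dist_triangle (u := u) (v := v) (w := c)
  rw [dist_eq_one_iff_adj.2 h] at h2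
  omega

theorem setLev_step (hG : G.Connected) (hC : C.Nonempty) {v : V} {k : ℕ}
    (h : setLev G C v = k + 1) : ∃ u, G.Adj v u ∧ setLev G C u = k := by
  obtain ⟨c, hc, hd⟩ := setLev_mem (G := G) hC v
  obtain ⟨u, hu, hud⟩ := geo_step hG (u := v) (c := c) (by
    rintro rfl
    rw [dist_self] at hd
    omega)
  refine ⟨u, hu, ?_⟩
  have h1 := setLev_le (G := G) (v := u) hc
  have h2 := setLev_adj hG hC hu
  omega

end lev

open Classical in
theorem count_levels {V : Type} [Fintype V] {G : SimpleGraph V} {R : ℕ} {C : Set V}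
    (h : CycCtx G R C) (d M : ℕ) (hd : 3 ≤ d)
    (hreg : ∀ v : V, Nat.card (G.neighborSet v) = d) (hMR : M + 1 ≤ R)
    (hM : ∀ v, setLev G C v ≤ M → C ⊆ gBall G v R) :
    ∀ k ≤ M, (Finset.univ.filter (fun v => setLev G C v ≤ k)).card
      = Nat.card C * (d - 1) ^ k := by
  have hne := h.cyc.2.1
  have huniq : ∀ w p q j, setLev G C w = j → 1 ≤ j → j ≤ M → G.Adj w p → G.Adj w q →
      setLev G C p ≤ j → setLev G C q ≤ j → p = q := by
    intro w p q j hw hj hjM hp hq hlp hlq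
    obtain ⟨c₁, hc₁, hd₁⟩ := setLev_mem (G := G) hne p
    obtain ⟨c₂, hc₂, hd₂⟩ := setLev_mem (G := G) hne q
    exact h.parent_unique (hM w (by omega)) hj (by omega) (fun c hc => hw ▸ setLev_le hc) hp hq
      hc₁ hc₂ (by omega) (by omega)
  have hdeg : ∀ v, (Finset.univ.filter (fun w => G.Adj v w)).card = d := by
    intro v
    rw [← hreg v, Nat.card_coe_set_eq, ← Set.ncard_coe_finset]
    congr 1
    ext w
    simp
  have hup : ∀ v k m, setLev G C v = k →
      (Finset.univ.filter (fun w => G.Adj v w ∧ setLev G C w ≤ k)).card = m →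
      (Finset.univ.filter (fun w => G.Adj v w ∧ setLev G C w = k + 1)).card = d - m := by
    intro v k m hv hm
    have h1 := Finset.card_filter_add_card_filter_not (s := Finset.univ.filter (fun w => G.Adj v w))
      (fun w => setLev G C w ≤ k)
    rw [hdeg, Finset.filter_filter, Finset.filter_filter, hm] at h1
    have h2 : (Finset.univ.filter (fun w => G.Adj v w ∧ setLev G C w = k + 1))
        = (Finset.univ.filter (fun w => G.Adj v w ∧ ¬ setLev G C w ≤ k)) := by
      ext w
      simp only [Finset.mem_filter, Finset.mem_univ, true_and]
      constructor
      · rintro ⟨h1, h2⟩; exact ⟨h1, by omega⟩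
      · rintro ⟨h1, h2⟩
        have := setLev_adj h.conn hne h1.symm
        exact ⟨h1, by omega⟩
    rw [h2]
    omega
  have hbelow : ∀ w k, setLev G C w = k + 1 → k + 1 ≤ M →
      (Finset.univ.filter (fun u => G.Adj w u ∧ setLev G C u ≤ k + 1)).card = 1 ∧
      (Finset.univ.filter (fun u => G.Adj w u ∧ setLev G C u = k)).card = 1 := by
    intro w k hw hk
    obtain ⟨q, hq, hql⟩ := setLev_step h.conn hne hw
    constructor
    · rw [Finset.card_eq_one]
      refine ⟨q, ?_⟩
      ext u
      simp only [Finset.mem_filter, Finset.mem_univ, true_and, Finset.mem_singleton]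
      constructor
      · rintro ⟨h1, h2⟩
        exact huniq w u q (k + 1) hw (by omega) hk h1 hq h2 (by omega)
      · rintro rfl; exact ⟨hq, by omega⟩
    · rw [Finset.card_eq_one]
      refine ⟨q, ?_⟩
      ext u
      simp only [Finset.mem_filter, Finset.mem_univ, true_and, Finset.mem_singleton]
      constructor
      · rintro ⟨h1, h2⟩
        exact huniq w u q (k + 1) hw (by omega) hk h1 hq (by omega) (by omega)
      · rintro rfl; exact ⟨hq, by omega⟩
  have hdouble : ∀ k m, k + 1 ≤ M → (∀ v, setLev G C v = k →
      (Finset.univ.filter (fun w => G.Adj v w ∧ setLev G C w ≤ k)).card = m) →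
      (Finset.univ.filter (fun v => setLev G C v = k + 1)).card =
        (Finset.univ.filter (fun v => setLev G C v = k)).card * (d - m) := by
    intro k m hk hm
    have := Finset.card_mul_eq_card_mul (s := Finset.univ.filter (fun v => setLev G C v = k))
      (t := Finset.univ.filter (fun v => setLev G C v = k + 1)) (fun u v => G.Adj u v)
      (m := d - m) (n := 1) ?_ ?_
    · rw [this, mul_one]
    · intro v hv
      have hv : setLev G C v = k := by simpa using hv
      rw [← hup v k m hv (hm v hv), Finset.bipartiteAbove, Finset.filter_filter]
      congr 1
      ext w
      simp [and_comm]
    · intro w hw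
      have hw : setLev G C w = k + 1 := by simpa using hw
      rw [← (hbelow w k hw hk).2, Finset.bipartiteBelow, Finset.filter_filter]
      congr 1
      ext u
      simp [and_comm, G.adj_comm]
  have hs0 : (Finset.univ.filter (fun v => setLev G C v = 0)).card = Nat.card C := by
    rw [Nat.card_coe_set_eq, ← Set.ncard_coe_finset]
    congr 1
    ext v
    simp [setLev_zero h.conn hne]
  have hs : ∀ k, k + 1 ≤ M → (Finset.univ.filter (fun v => setLev G C v = k + 1)).card =
      Nat.card C * (d - 2) * (d - 1) ^ k := by
    intro k
    induction k with
    | zero =>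
      intro hk
      rw [hdouble 0 2 hk, hs0, pow_zero, mul_one]
      intro v hv
      rw [setLev_zero h.conn hne] at hv
      rw [← h.cyc.2.2.2 v hv]
      change _ = Nat.card ({w : V | w ∈ C ∧ G.Adj v w} : Set V)
      rw [Nat.card_coe_set_eq, ← Set.ncard_coe_finset]
      congr 1
      ext w
      simp [setLev_zero h.conn hne, and_comm]
    | succ k ih =>
      intro hk
      rw [hdouble (k + 1) 1 hk (fun v hv => (hbelow v k hv (by omega)).1), ih (by omega), pow_succ]
      ring
  intro k
  induction k with
  | zero =>
    intro _
    rw [pow_zero, mul_one, ← hs0]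
    simp
  | succ k ih =>
    intro hk
    have h1 : Finset.univ.filter (fun v => setLev G C v ≤ k + 1) =
        Finset.univ.filter (fun v => setLev G C v ≤ k) ∪
        Finset.univ.filter (fun v => setLev G C v = k + 1) := by
      ext v
      simp only [Finset.mem_filter, Finset.mem_univ, true_and, Finset.mem_union]
      omega
    rw [h1, Finset.card_union_of_disjoint, ih (by omega), hs k hk]
    · obtain ⟨e, rfl⟩ : ∃ e, d = e + 3 := ⟨d - 3, by omega⟩
      rw [show e + 3 - 2 = e + 1 by omega, show e + 3 - 1 = e + 2 by omega, pow_succ]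
      ring
    · rw [Finset.disjoint_left]
      intro v hv hv'
      simp only [Finset.mem_filter, Finset.mem_univ, true_and] at hv hv'
      omega

/-- Structure of the neighbourhood of the unique cycle: in a `d`-regular graph
in which every `R`-ball contains at most one cycle, let `C` be a cycle with
`|C| ≤ 2R+1` and `ℓ_C = ⌊|C|/2⌋`.  Then `N_C(R) = {y : C ⊆ B(y,R)}` equals
`B(C, R-ℓ_C)`, it decomposes as the disjoint union over `y ∈ C` of the trees
`T y` (the vertices strictly closer to `y` than to any other cycle vertex,
within distance `R-ℓ_C` of `y`), each `T y` induces a tree (connected and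
acyclic) of depth `R-ℓ_C` rooted at `y`, and `|N_C(R)| = |C|·(d-1)^{R-ℓ_C}`. -/
theorem stmt_12 {V : Type} [Fintype V] (G : SimpleGraph V) (d R : ℕ)
    (hd : 3 ≤ d)
    (hreg : ∀ v : V, Nat.card (G.neighborSet v) = d)
    (hball : ∀ x : V, {C : Set V | C ⊆ gBall G x R ∧ IsCycleSet G C}.Subsingleton)
    (C : Set V) (hC : IsCycleSet G C) (hClen : Nat.card ↥C ≤ 2 * R + 1)
    (ℓ : ℕ) (hℓ : ℓ = Nat.card ↥C / 2)
    (N : Set V) (hN : N = {y : V | C ⊆ gBall G y R})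
    (T : V → Set V)
    (hT : ∀ y, T y = {v : V | G.dist y v ≤ R - ℓ ∧
        ∀ z ∈ C, z ≠ y → G.dist v y < G.dist v z}) :
    N = (⋃ y ∈ C, gBall G y (R - ℓ))
      ∧ N = (⋃ y ∈ C, T y)
      ∧ (∀ y ∈ C, ∀ z ∈ C, y ≠ z → T y ∩ T z = ∅)
      ∧ (∀ y ∈ C, (G.induce (T y)).Connected ∧ (G.induce (T y)).IsAcyclic
            ∧ y ∈ T y ∧ ∀ v ∈ T y, G.dist y v ≤ R - ℓ)
      ∧ Nat.card ↥N = Nat.card ↥C * (d - 1) ^ (R - ℓ) := by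
  classical
  have hne := hC.2.1
  obtain ⟨c₀, hc₀⟩ := hne
  have hconn : G.Connected := graph_connected G d R hd hreg hball ⟨c₀⟩
  have ctx : CycCtx G R C := ⟨hconn, hball, hC⟩
  have h2 : ∀ y ∈ C, ∃ z ∈ C, z ≠ y := by
    intro y hy
    have h := hC.2.2.2 y hy
    have : Nonempty {w : V // w ∈ C ∧ G.Adj y w} := by
      by_contra hh
      rw [not_nonempty_iff] at hh
      rw [Nat.card_of_isEmpty] at h
      omega
    obtain ⟨w, hw, hw'⟩ := this
    exact ⟨w, hw, hw'.ne'⟩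
  have hℓ1 : 1 ≤ ℓ := by
    obtain ⟨z, hz, hne⟩ := h2 c₀ hc₀
    have h1 := cycle_diam hC hc₀ hz
    have h3 := hconn.pos_dist_of_ne hne.symm
    omega
  have hℓR : ℓ ≤ R := by omega
  have hin : ∀ y ∈ C, ∀ v, G.dist y v ≤ R - ℓ → C ⊆ gBall G v R := by
    intro y hy v hv z hz
    have h1 := cycle_diam hC hy hz
    have h3 := hconn.dist_triangle (u := v) (v := y) (w := z)
    rw [dist_comm] at hv
    change G.dist v z ≤ R
    omega
  have hgate : ∀ v, C ⊆ gBall G v R → ∃ c ∈ C, G.dist c v ≤ R - ℓ ∧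
      ∀ z ∈ C, z ≠ c → G.dist v c < G.dist v z := by
    intro v hv
    obtain ⟨c, hc, k, hk⟩ := ctx.gate _ v ⟨c₀, hc₀, rfl⟩ hv
    have hkc := hk c hc
    rw [dist_self] at hkc
    have hkR : G.dist v c ≤ R := hv hc
    refine ⟨c, hc, ?_, ?_⟩
    · have := ctx.card_le (m := R - k) hc (by omega) (by
        intro z hz
        have h1 : G.dist v z ≤ R := hv hz
        have h3 := hk z hz
        change G.dist c z ≤ R - k
        omega)
      rw [dist_comm]
      omega
    · intro z hz hzc
      have h1 := hk z hz
      have h3 := hconn.pos_dist_of_ne hzc.symm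
      omega
  have hN1 : N = (⋃ y ∈ C, gBall G y (R - ℓ)) := by
    rw [hN]
    ext v
    rw [Set.mem_iUnion₂]
    constructor
    · intro hv
      obtain ⟨c, hc, h1, -⟩ := hgate v hv
      exact ⟨c, hc, h1⟩
    · rintro ⟨y, hy, hv⟩
      exact hin y hy v hv
  have hTy : ∀ y ∈ C, y ∈ T y := by
    intro y hy
    rw [hT]
    refine ⟨by simp, ?_⟩
    intro z hz hzy
    rw [dist_self]
    exact hconn.pos_dist_of_ne hzy.symm
  refine ⟨hN1, ?_, ?_, ?_, ?_⟩
  · rw [hN]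
    ext v
    rw [Set.mem_iUnion₂]
    constructor
    · intro hv
      obtain ⟨c, hc, h1⟩ := hgate v hv
      refine ⟨c, hc, ?_⟩
      rw [hT]
      exact h1
    · rintro ⟨y, hy, hv⟩
      rw [hT] at hv
      exact hin y hy v hv.1
  · intro y hy z hz hyz
    rw [Set.eq_empty_iff_forall_notMem]
    rintro v ⟨h1, h3⟩
    rw [hT] at h1 h3
    have h4 := h1.2 z hz hyz.symm
    have h5 := h3.2 y hy hyz
    omega
  · intro y hy
    refine ⟨?_, ?_, hTy y hy, ?_⟩
    · rw [connected_iff_exists_forall_reachable]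
      refine ⟨⟨y, hTy y hy⟩, ?_⟩
      have key : ∀ (n : ℕ) (v : V) (hv : v ∈ T y), G.dist v y = n →
          (G.induce (T y)).Reachable ⟨y, hTy y hy⟩ ⟨v, hv⟩ := by
        intro n
        induction n with
        | zero =>
          intro v hv hd0
          rw [hconn.dist_eq_zero_iff] at hd0
          subst hd0
          exact Reachable.refl _
        | succ n ih =>
          intro v hv hd0
          obtain ⟨p, hp, hpd⟩ := geo_step hconn (u := v) (c := y) (by
            rintro rfl
            rw [dist_self] at hd0
            omega)
          have hpT : p ∈ T y := by
            rw [hT] at hv ⊢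
            refine ⟨?_, ?_⟩
            · have := hv.1
              rw [dist_comm] at this
              rw [dist_comm]
              omega
            · intro z hz hzy
              have h1 := hv.2 z hz hzy
              have h3 := hconn.dist_triangle (u := v) (v := p) (w := z)
              rw [dist_eq_one_iff_adj.2 hp] at h3
              omega
          refine (ih p hpT (by omega)).trans (Adj.reachable ?_)
          exact hp.symm
      rintro ⟨v, hv⟩
      exact key _ v hv rfl
    · by_contra hac
      obtain ⟨D, hD, hDc⟩ := exists_cycleSet_of_not_acyclic G (T y) hac
      have hDC : D = C := by
        refine hball y ⟨?_, hDc⟩ ⟨hin y hy y (by simp), hC⟩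
        intro v hv
        have := hD hv
        rw [hT] at this
        exact le_trans this.1 (by omega)
      obtain ⟨z, hz, hzy⟩ := h2 y hy
      have hzT := hD (hDC ▸ hz)
      rw [hT] at hzT
      have := hzT.2 z hz hzy
      rw [dist_self] at this
      omega
    · intro v hv
      rw [hT] at hv
      exact hv.1
  · have hlev : ∀ v, setLev G C v ≤ R - ℓ ↔ ∃ y ∈ C, G.dist y v ≤ R - ℓ := by
      intro v
      constructor
      · intro hv
        obtain ⟨c, hc, hcd⟩ := setLev_mem (G := G) ⟨c₀, hc₀⟩ v
        exact ⟨c, hc, by rw [dist_comm]; omega⟩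
      · rintro ⟨y, hy, hv⟩
        have := setLev_le (G := G) (v := v) hy
        rw [dist_comm] at this
        omega
    rw [← count_levels ctx d (R - ℓ) hd hreg (by omega) (by
      intro v hv
      obtain ⟨y, hy, hv⟩ := (hlev v).1 hv
      exact hin y hy v hv) (R - ℓ) le_rfl, Nat.card_coe_set_eq, ← Set.ncard_coe_finset, hN1]
    congr 1
    ext v
    simp [hlev, gBall]
end
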